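/- Let α and β be odd, positive, relatively prime integers, and let Λ' ⊂ ℝ⁴ be the ℤ-span of the rows of the matrix G' = [[0, α, 0, β], [(−α−β)/2, (−α+β)/2, (α−β)/2, (−α−β)/2], [(α−β)/2, (−α−β)/2, (α+β)/2, (α−β)/2], [(α+β)/2, (−α+β)/2, (−α+β)/2, (−α−β)/2]]. Then Λ' is a sublattice of D4, geometrically strictly similar to D4, of index ((α² + β²)/2)² in D4, and Λ' is clean in D4. -/

import Mathlib

/-- The lattice `D4 = {x ∈ ℤ⁴ : x 0 + x 1 + x 2 + x 3 is even}` inside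
`EuclideanSpace ℝ (Fin 4)`. -/
noncomputable def D4 : AddSubgroup (EuclideanSpace ℝ (Fin 4)) where
  carrier := {x | ∃ v : Fin 4 → ℤ, (∀ i, x i = (v i : ℝ)) ∧ Even (v 0 + v 1 + v 2 + v 3)}
  zero_mem' := ⟨0, fun i => by simp, by simp⟩
  add_mem' := by
    rintro x y ⟨v, hv, kv, hkv⟩ ⟨w, hw, kw, hkw⟩
    refine ⟨v + w, fun i => ?_, kv + kw, by simp only [Pi.add_apply]; omega⟩
    have : (x + y) i = x i + y i := rfl
    rw [this, hv i, hw i, Pi.add_apply]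
    push_cast
    ring
  neg_mem' := by
    rintro x ⟨v, hv, kv, hkv⟩
    refine ⟨-v, fun i => ?_, -kv, by simp only [Pi.neg_apply]; omega⟩
    have : (-x) i = -(x i) := rfl
    rw [this, hv i, Pi.neg_apply]
    push_cast
    ring

/-- `Λ'` is clean in `Λ`: every point of `Λ` has a unique nearest point of `Λ'`
in the Euclidean norm. -/
def IsClean (Λ Λ' : AddSubgroup (EuclideanSpace ℝ (Fin 4))) : Prop :=
  ∀ x ∈ Λ, ∃! p, p ∈ Λ' ∧ ∀ q ∈ Λ', ‖x - p‖ ≤ ‖x - q‖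

/-- `Λ'` is a geometrically similar sublattice of `Λ` of index `N`:
`Λ' = {c·O(v) : v ∈ Λ}` for some `c > 0` and orthogonal matrix `O`, with
`[Λ : Λ'] = N`. -/
def IsSimilarSublattice (Λ Λ' : AddSubgroup (EuclideanSpace ℝ (Fin 4))) (N : ℕ) : Prop :=
  Λ' ≤ Λ ∧ (Λ'.addSubgroupOf Λ).index = N ∧
    ∃ (c : ℝ) (O : Matrix (Fin 4) (Fin 4) ℝ), 0 < c ∧ O * O.transpose = 1 ∧
      Λ' = AddSubgroup.map (c • Matrix.toEuclideanLin O).toAddMonoidHom Λ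

/-- `Λ'` is a geometrically strictly similar sublattice of `Λ` of index `N`:
as above, but additionally `det O = 1` (no reflections). -/
def IsStrictlySimilarSublattice (Λ Λ' : AddSubgroup (EuclideanSpace ℝ (Fin 4))) (N : ℕ) : Prop :=
  Λ' ≤ Λ ∧ (Λ'.addSubgroupOf Λ).index = N ∧
    ∃ (c : ℝ) (O : Matrix (Fin 4) (Fin 4) ℝ), 0 < c ∧ O * O.transpose = 1 ∧ O.det = 1 ∧
      Λ' = AddSubgroup.map (c • Matrix.toEuclideanLin O).toAddMonoidHom Λ

/-- The generator matrix `G' = G·R_ξ` for the sublattice `D4·ξ`, where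
`ξ = (α/2)(1+i) + (β/2)(j+k)`. -/
noncomputable def Gp (α β : ℝ) : Matrix (Fin 4) (Fin 4) ℝ :=
  !![0, α, 0, β;
     (-α - β) / 2, (-α + β) / 2, (α - β) / 2, (-α - β) / 2;
     (α - β) / 2, (-α - β) / 2, (α + β) / 2, (α - β) / 2;
     (α + β) / 2, (-α + β) / 2, (-α + β) / 2, (-α - β) / 2]

/-- The `ℤ`-span of the rows of `G'`, as an additive subgroup of `ℝ⁴`. -/
noncomputable def GpLattice (α β : ℝ) : AddSubgroup (EuclideanSpace ℝ (Fin 4)) :=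
  AddSubgroup.closure (Set.range fun i => (WithLp.equiv 2 (Fin 4 → ℝ)).symm (Gp α β i))

open Matrix

/-- The squared Euclidean norm of an integer vector. -/
def sqNorm (v : Fin 4 → ℤ) : ℤ := v 0 ^ 2 + v 1 ^ 2 + v 2 ^ 2 + v 3 ^ 2

/-- The inclusion of `ℤ⁴` into Euclidean space. -/
noncomputable def intVec : (Fin 4 → ℤ) →+ EuclideanSpace ℝ (Fin 4) where
  toFun v := WithLp.toLp 2 fun i => (v i : ℝ)
  map_zero' := by ext i; simp
  map_add' v w := by ext i; simp

@[simp] lemma intVec_apply (v : Fin 4 → ℤ) (i : Fin 4) : intVec v i = v i := rfl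

lemma intVec_injective : Function.Injective intVec := fun v w h => by
  ext i
  have := congrArg (fun x : EuclideanSpace ℝ (Fin 4) => x i) h
  simpa using this

lemma norm_intVec_le_iff (v w : Fin 4 → ℤ) :
    ‖intVec v‖ ≤ ‖intVec w‖ ↔ sqNorm v ≤ sqNorm w := by
  rw [← abs_norm (intVec v), ← abs_norm (intVec w), ← sq_le_sq, EuclideanSpace.norm_sq_eq,
    EuclideanSpace.norm_sq_eq]
  simp only [Fin.sum_univ_four, intVec_apply, Real.norm_eq_abs, sq_abs, sqNorm]
  exact_mod_cast Iff.rfl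

/-- A `ℤ`-basis of `D4`, as the rows of a matrix. -/
def d4Basis : Matrix (Fin 4) (Fin 4) ℤ :=
  !![1, 1, 0, 0; -1, 0, 1, 0; 0, -1, 0, 1; 0, -1, 0, -1]

/-- The coordinates, in the rows of `d4Basis`, of the rows of `Gp (2a+1) (2b+1)`. -/
def gpCoord (a b : ℤ) : Matrix (Fin 4) (Fin 4) ℤ :=
  !![0, 0, b - a, -(a + b + 1);
     -(2 * b + 1), a - b, -(2 * b + 1), a - b;
     2 * a + 1, a + b + 1, 2 * a + 1, a + b + 1;
     2 * b + 1, b - a, 0, a + b + 1]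

lemma d4Basis_vecMul (c : Fin 4 → ℤ) :
    c ᵥ* d4Basis = ![c 0 - c 1, c 0 - c 2 - c 3, c 1, c 2 - c 3] := by
  ext i
  fin_cases i <;> simp [vecMul, dotProduct, Fin.sum_univ_four, d4Basis] <;> ring

lemma d4Basis_det : d4Basis.det ≠ 0 := by decide

/-- The linear combinations of the rows of an integer matrix with integer coefficients. -/
def rowSpan (M : Matrix (Fin 4) (Fin 4) ℤ) : AddSubgroup (Fin 4 → ℤ) :=
  M.vecMulLinear.toAddMonoidHom.range

lemma mem_rowSpan {M : Matrix (Fin 4) (Fin 4) ℤ} {v : Fin 4 → ℤ} :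
    v ∈ rowSpan M ↔ ∃ c, c ᵥ* M = v := Iff.rfl

lemma closure_range_intVec (M : Matrix (Fin 4) (Fin 4) ℤ) :
    AddSubgroup.closure (Set.range fun i => intVec (M i)) = (rowSpan M).map intVec := by
  apply le_antisymm
  · rw [AddSubgroup.closure_le]
    rintro _ ⟨i, rfl⟩
    exact AddSubgroup.mem_map.mpr ⟨M i, mem_rowSpan.mpr ⟨Pi.single i 1, by ext j; simp⟩, rfl⟩
  · rintro _ ⟨_, ⟨c, rfl⟩, rfl⟩
    have : intVec (M.vecMulLinear.toAddMonoidHom c) = ∑ i, c i • intVec (M i) := by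
      ext j
      simp [vecMul, dotProduct]
    rw [this]
    exact sum_mem fun i _ => zsmul_mem (AddSubgroup.subset_closure (Set.mem_range_self i)) _

lemma D4_eq_map_rowSpan : D4 = (rowSpan d4Basis).map intVec := by
  ext x
  constructor
  · rintro ⟨v, hv, k, hk⟩
    refine ⟨v, mem_rowSpan.mpr ⟨![v 0 + v 2, v 2, k - v 1, k - v 1 - v 3], ?_⟩, ?_⟩
    · rw [d4Basis_vecMul]
      ext i
      fin_cases i <;> simp
      omega
    · ext i
      simp [hv i]
  · rintro ⟨_, ⟨c, rfl⟩, rfl⟩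
    refine ⟨c ᵥ* d4Basis, fun i => rfl, c 0 - c 3, ?_⟩
    simp [d4Basis_vecMul]
    ring

lemma rowSpan_mul (A B : Matrix (Fin 4) (Fin 4) ℤ) :
    rowSpan (A * B) = (rowSpan A).map B.vecMulLinear.toAddMonoidHom := by
  ext v
  simp [mem_rowSpan, vecMul_vecMul]

lemma vecMul_injective_of_det_ne_zero {M : Matrix (Fin 4) (Fin 4) ℤ} (h : M.det ≠ 0) :
    Function.Injective M.vecMulLinear := by
  rw [injective_iff_map_eq_zero]
  intro v hv
  exact Matrix.eq_zero_of_vecMul_eq_zero h hv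

lemma index_rowSpan {M : Matrix (Fin 4) (Fin 4) ℤ} (h : M.det ≠ 0) :
    (rowSpan M).index = M.det.natAbs := by
  have key := Submodule.natAbs_det_equiv (LinearMap.range M.vecMulLinear)
    (LinearEquiv.ofInjective M.vecMulLinear (vecMul_injective_of_det_ne_zero h))
  have hdet : LinearMap.det M.vecMulLinear = M.det := by
    have : M.vecMulLinear = Matrix.toLin' Mᵀ := by
      ext i j
      simp [Matrix.toLin'_apply]
    rw [this, LinearMap.det_toLin', det_transpose]
  rw [← hdet]
  exact key.symm

lemma gpCoord_det (a b : ℤ) :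
    (gpCoord a b).det = (2 * a ^ 2 + 2 * a + 2 * b ^ 2 + 2 * b + 1) ^ 2 := by
  rw [gpCoord, det_succ_row_zero]
  simp [Fin.sum_univ_four, det_fin_three, Fin.succAbove, submatrix]
  ring

lemma intVec_gpCoord_mul (a b : ℤ) (i : Fin 4) :
    intVec ((gpCoord a b * d4Basis) i) =
      (WithLp.equiv 2 (Fin 4 → ℝ)).symm (Gp ((2 * a + 1 : ℤ) : ℝ) ((2 * b + 1 : ℤ) : ℝ) i) := by
  ext j
  fin_cases i <;> fin_cases j <;>
    simp [gpCoord, d4Basis, Gp] <;> ring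

lemma GpLattice_eq_map_rowSpan (a b : ℤ) :
    GpLattice ((2 * a + 1 : ℤ) : ℝ) ((2 * b + 1 : ℤ) : ℝ) =
      (rowSpan (gpCoord a b * d4Basis)).map intVec := by
  rw [← closure_range_intVec, GpLattice]
  simp_rw [intVec_gpCoord_mul]

lemma relIndex_GpLattice (a b : ℤ) :
    (GpLattice ((2 * a + 1 : ℤ) : ℝ) ((2 * b + 1 : ℤ) : ℝ)).relIndex D4 =
      ((2 * a ^ 2 + 2 * a + 2 * b ^ 2 + 2 * b + 1) ^ 2).natAbs := by
  have h1 : rowSpan d4Basis = (⊤ : AddSubgroup _).map d4Basis.vecMulLinear.toAddMonoidHom := by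
    rw [← AddMonoidHom.range_eq_map]; rfl
  rw [GpLattice_eq_map_rowSpan, D4_eq_map_rowSpan,
    AddSubgroup.relIndex_map_map_of_injective _ _ intVec_injective, rowSpan_mul, h1,
    AddSubgroup.relIndex_map_map_of_injective _ _
      (vecMul_injective_of_det_ne_zero d4Basis_det),
    AddSubgroup.relIndex_top_right, index_rowSpan, gpCoord_det]
  rw [gpCoord_det]
  have : 2 * a ^ 2 + 2 * a + 2 * b ^ 2 + 2 * b + 1 ≠ 0 := by
    intro h; have : (2 * (a ^ 2 + a + b ^ 2 + b) + 1 : ℤ) = 0 := by linarith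
    omega
  exact pow_ne_zero 2 this

/-- Right multiplication by the quaternion `(α/2)(1+i) + (β/2)(j+k)`, acting on columns. -/
noncomputable def rightMul (α β : ℝ) : Matrix (Fin 4) (Fin 4) ℝ :=
  (1 / 2 : ℝ) • !![α, -α, -β, -β; α, α, β, -β; β, -β, α, α; β, β, -α, α]

lemma rightMul_mul_transpose (α β : ℝ) :
    rightMul α β * (rightMul α β)ᵀ = ((α ^ 2 + β ^ 2) / 2) • (1 : Matrix (Fin 4) (Fin 4) ℝ) := by
  ext i j
  fin_cases i <;> fin_cases j <;>
    simp [rightMul, Matrix.mul_apply, Fin.sum_univ_four, Matrix.transpose] <;> ring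

lemma rightMul_det (α β : ℝ) : (rightMul α β).det = ((α ^ 2 + β ^ 2) / 2) ^ 2 := by
  rw [rightMul, det_smul, det_succ_row_zero]
  simp [Fin.sum_univ_four, det_fin_three, Fin.succAbove, submatrix]
  ring

lemma rightMul_d4Basis (α β : ℝ) (i : Fin 4) :
    (Matrix.toEuclideanLin (rightMul α β)) (intVec (d4Basis i)) =
      (WithLp.equiv 2 (Fin 4 → ℝ)).symm (Gp α β i) := by
  ext j
  fin_cases i <;> fin_cases j <;>
    simp [rightMul, d4Basis, Gp, Matrix.toLpLin_apply, dotProduct,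
      Fin.sum_univ_four] <;> ring

lemma exists_rotation (α β : ℝ) (h : 0 < α ^ 2 + β ^ 2) :
    ∃ (c : ℝ) (O : Matrix (Fin 4) (Fin 4) ℝ), 0 < c ∧ O * O.transpose = 1 ∧ O.det = 1 ∧
      GpLattice α β = AddSubgroup.map (c • Matrix.toEuclideanLin O).toAddMonoidHom D4 := by
  have hm : 0 < (α ^ 2 + β ^ 2) / 2 := by positivity
  set c := √((α ^ 2 + β ^ 2) / 2) with hc
  have hc0 : 0 < c := Real.sqrt_pos.mpr hm
  have hc2 : c ^ 2 = (α ^ 2 + β ^ 2) / 2 := Real.sq_sqrt hm.le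
  refine ⟨c, c⁻¹ • rightMul α β, hc0, ?_, ?_, ?_⟩
  · rw [transpose_smul, smul_mul_smul_comm, rightMul_mul_transpose, smul_smul, ← hc2]
    rw [show c⁻¹ * c⁻¹ * c ^ 2 = 1 by field_simp, one_smul]
  · rw [det_smul, rightMul_det, ← hc2, Fintype.card_fin]
    field_simp
  · rw [map_smul, smul_smul, mul_inv_cancel₀ hc0.ne', one_smul, D4_eq_map_rowSpan,
      ← closure_range_intVec, AddMonoidHom.map_closure, ← Set.range_comp, GpLattice]
    congr 2
    ext1 i
    exact (rightMul_d4Basis α β i).symm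

section Arithmetic

variable {m α β y₀ y₁ y₂ y₃ : ℤ}

/-- If two of four integers have absolute values summing to the odd number `m`, all pairs have
absolute values summing to at most `m` and the total is even, then neither the sum nor the
difference of the other two is divisible by `m`. -/
lemma not_dvd_of_abs_add_abs_eq (hm : Odd m) (hm0 : 0 < m) {p q r s k : ℤ}
    (hpq : |p| + |q| = m) (hpr : |p| + |r| ≤ m) (hps : |p| + |s| ≤ m) (hqr : |q| + |r| ≤ m)
    (hqs : |q| + |s| ≤ m) (hrs : |r| + |s| ≤ m) (he : Even (p + q + r + s))
    (hk : r + s = m * k ∨ r - s = m * k) : False := by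
  obtain ⟨n, rfl⟩ := hm
  obtain ⟨l, hl⟩ := he
  have := abs_eq_max_neg (a := p)
  have := abs_eq_max_neg (a := q)
  have := abs_eq_max_neg (a := r)
  have := abs_eq_max_neg (a := s)
  rcases lt_trichotomy k 0 with h | h | h
  · have : (2 * n + 1) * k ≤ (2 * n + 1) * (-1) := mul_le_mul_of_nonneg_left (by omega) hm0.le
    rcases hk with hk | hk <;> omega
  · subst h
    simp only [mul_zero] at hk
    omega
  · have : (2 * n + 1) * 1 ≤ (2 * n + 1) * k := mul_le_mul_of_nonneg_left (by omega) hm0.le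
    rcases hk with hk | hk <;> omega

lemma abs_add_abs_ne_of_dvd (hm : Odd m) (hm0 : 0 < m) {p q r s : ℤ}
    (hpr : |p| + |r| ≤ m) (hps : |p| + |s| ≤ m) (hqr : |q| + |r| ≤ m)
    (hqs : |q| + |s| ≤ m) (he : Even (p + q + r + s)) (hp : m ∣ p) : |p| + |q| ≠ m := by
  intro hpq
  obtain ⟨n, rfl⟩ := hm
  obtain ⟨l, hl⟩ := he
  have hp' : p = 0 ∨ |p| = 2 * n + 1 := by
    by_cases h : p = 0
    · exact Or.inl h
    · have := Int.le_of_dvd (abs_pos.mpr h) ((dvd_abs _ _).mpr hp)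
      right
      have := abs_nonneg q
      omega
  have := abs_eq_max_neg (a := p)
  have := abs_eq_max_neg (a := q)
  have := abs_eq_max_neg (a := r)
  have := abs_eq_max_neg (a := s)
  omega

lemma eq_or_eq_of_abs_add_abs_eq {p q : ℤ} (h : |p| + |q| = m) :
    (∃ k, p + q = m * k) ∨ ∃ k, p - q = m * k := by
  have : p + q = m ∨ p + q = -m ∨ p - q = m ∨ p - q = -m := by
    have := abs_eq_max_neg (a := p)
    have := abs_eq_max_neg (a := q)
    omega
  rcases this with h | h | h | h
  · exact Or.inl ⟨1, by omega⟩
  · exact Or.inl ⟨-1, by omega⟩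
  · exact Or.inr ⟨1, by omega⟩
  · exact Or.inr ⟨-1, by omega⟩

/-- A vector satisfying the congruences `α y₀ ≡ β y₃` and `α y₁ ≡ -β y₂` modulo
`m = (α² + β²) / 2` cannot lie on the boundary of the 24-cell `|yᵢ| + |yⱼ| ≤ m`. -/
lemma abs_add_abs_lt (hm : Odd m) (hm0 : 0 < m) (hmαβ : 2 * m = α ^ 2 + β ^ 2)
    (hα : IsCoprime m α) (hβ : IsCoprime m β) (he : Even (y₀ + y₁ + y₂ + y₃))
    (h1 : m ∣ α * y₀ - β * y₃) (h2 : m ∣ α * y₁ + β * y₂)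
    (h01 : |y₀| + |y₁| ≤ m) (h02 : |y₀| + |y₂| ≤ m) (h03 : |y₀| + |y₃| ≤ m)
    (h12 : |y₁| + |y₂| ≤ m) (h13 : |y₁| + |y₃| ≤ m) (h23 : |y₂| + |y₃| ≤ m) :
    |y₀| + |y₁| < m ∧ |y₀| + |y₂| < m ∧ |y₀| + |y₃| < m ∧
      |y₁| + |y₂| < m ∧ |y₁| + |y₃| < m ∧ |y₂| + |y₃| < m := by
  have hm2 : IsCoprime m 2 := by
    obtain ⟨n, rfl⟩ := hm
    exact ⟨1, -n, by ring⟩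
  have hαα : IsCoprime m (2 * α ^ 2) := hm2.mul_right (hα.pow_right)
  obtain ⟨k, hk⟩ := h1
  obtain ⟨l, hl⟩ := h2
  -- the two companion congruences follow from `α² + β² ≡ 0`
  obtain ⟨k', hk'⟩ : m ∣ β * y₀ + α * y₃ := hα.dvd_of_dvd_mul_left
    ⟨β * k + 2 * y₃, by linear_combination β * hk - y₃ * hmαβ⟩
  obtain ⟨l', hl'⟩ : m ∣ β * y₁ - α * y₂ := hα.dvd_of_dvd_mul_left
    ⟨β * l - 2 * y₂, by linear_combination β * hl + y₂ * hmαβ⟩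
  refine ⟨lt_of_le_of_ne h01 fun h => ?_, lt_of_le_of_ne h02 fun h => ?_,
    lt_of_le_of_ne h03 fun h => ?_, lt_of_le_of_ne h12 fun h => ?_,
    lt_of_le_of_ne h13 fun h => ?_, lt_of_le_of_ne h23 fun h => ?_⟩
  · obtain ⟨j, hj⟩ : ∃ j, y₂ + y₃ = m * j ∨ y₂ - y₃ = m * j := by
      rcases eq_or_eq_of_abs_add_abs_eq h with ⟨n, hn⟩ | ⟨n, hn⟩
      · obtain ⟨j, hj⟩ : m ∣ y₂ - y₃ := hβ.dvd_of_dvd_mul_left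
          ⟨k + l - α * n, by linear_combination hk + hl - α * hn⟩
        exact ⟨j, Or.inr hj⟩
      · obtain ⟨j, hj⟩ : m ∣ y₂ + y₃ := hβ.dvd_of_dvd_mul_left
          ⟨l - k + α * n, by linear_combination hl - hk + α * hn⟩
        exact ⟨j, Or.inl hj⟩
    exact not_dvd_of_abs_add_abs_eq hm hm0 h h02 h03 h12 h13 h23 he hj
  · obtain ⟨j, hj⟩ : ∃ j, y₁ + y₃ = m * j ∨ y₁ - y₃ = m * j := by
      rcases eq_or_eq_of_abs_add_abs_eq h with ⟨n, hn⟩ | ⟨n, hn⟩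
      · obtain ⟨j, hj⟩ : m ∣ y₁ + y₃ := hβ.dvd_of_dvd_mul_left
          ⟨l' - k + α * n, by linear_combination hl' - hk + α * hn⟩
        exact ⟨j, Or.inl hj⟩
      · obtain ⟨j, hj⟩ : m ∣ y₁ - y₃ := hβ.dvd_of_dvd_mul_left
          ⟨l' + k - α * n, by linear_combination hl' + hk - α * hn⟩
        exact ⟨j, Or.inr hj⟩
    exact not_dvd_of_abs_add_abs_eq hm hm0 h h01 h03 (by omega) h23 h13
      (by convert he using 1; ring) hj
  · refine abs_add_abs_ne_of_dvd hm hm0 h01 h02 (by omega) (by omega)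
      (by convert he using 1; ring) ?_ h
    rcases eq_or_eq_of_abs_add_abs_eq h with ⟨n, hn⟩ | ⟨n, hn⟩
    · exact hαα.dvd_of_dvd_mul_left ⟨(α - β) * (k + β * n) + 2 * y₀, by
        linear_combination (α - β) * hk + (α - β) * β * hn - y₀ * hmαβ⟩
    · exact hαα.dvd_of_dvd_mul_left ⟨(α + β) * (k - β * n) + 2 * y₀, by
        linear_combination (α + β) * hk - (α + β) * β * hn - y₀ * hmαβ⟩
  · refine abs_add_abs_ne_of_dvd hm hm0 (r := y₀) (s := y₃) (by omega) h13 (by omega) h23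
      (by convert he using 1; ring) ?_ h
    rcases eq_or_eq_of_abs_add_abs_eq h with ⟨n, hn⟩ | ⟨n, hn⟩
    · exact hαα.dvd_of_dvd_mul_left ⟨(α + β) * (l - β * n) + 2 * y₁, by
        linear_combination (α + β) * hl - (α + β) * β * hn - y₁ * hmαβ⟩
    · exact hαα.dvd_of_dvd_mul_left ⟨(α - β) * (l + β * n) + 2 * y₁, by
        linear_combination (α - β) * hl + (α - β) * β * hn - y₁ * hmαβ⟩
  · obtain ⟨j, hj⟩ : ∃ j, y₀ + y₂ = m * j ∨ y₀ - y₂ = m * j := by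
      rcases eq_or_eq_of_abs_add_abs_eq h with ⟨n, hn⟩ | ⟨n, hn⟩
      · obtain ⟨j, hj⟩ : m ∣ y₀ + y₂ := hα.dvd_of_dvd_mul_left
          ⟨k - l' + β * n, by linear_combination hk - hl' + β * hn⟩
        exact ⟨j, Or.inl hj⟩
      · obtain ⟨j, hj⟩ : m ∣ y₀ - y₂ := hα.dvd_of_dvd_mul_left
          ⟨k + l' - β * n, by linear_combination hk + hl' - β * hn⟩
        exact ⟨j, Or.inr hj⟩
    exact not_dvd_of_abs_add_abs_eq hm hm0 h (by omega) h12 (by omega) (by omega) h02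
      (by convert he using 1; ring) hj
  · obtain ⟨j, hj⟩ : ∃ j, y₀ + y₁ = m * j ∨ y₀ - y₁ = m * j := by
      rcases eq_or_eq_of_abs_add_abs_eq h with ⟨n, hn⟩ | ⟨n, hn⟩
      · obtain ⟨j, hj⟩ : m ∣ y₀ - y₁ := hα.dvd_of_dvd_mul_left
          ⟨k - l + β * n, by linear_combination hk - hl + β * hn⟩
        exact ⟨j, Or.inr hj⟩
      · obtain ⟨j, hj⟩ : m ∣ y₀ + y₁ := hα.dvd_of_dvd_mul_left
          ⟨k + l - β * n, by linear_combination hk + hl - β * hn⟩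
        exact ⟨j, Or.inl hj⟩
    exact not_dvd_of_abs_add_abs_eq hm hm0 h (by omega) (by omega) (by omega) (by omega) h01
      (by convert he using 1; ring) hj

lemma sum_sq_lt_sq {p q r s : ℤ} (hp : 0 ≤ p) (hq : 0 ≤ q) (hr : 0 ≤ r) (hs : 0 ≤ s)
    (hqp : q ≤ p) (hrp : r ≤ p) (hsp : s ≤ p)
    (hpq : p + q < m) (hpr : p + r < m) (hps : p + s < m) :
    p ^ 2 + q ^ 2 + r ^ 2 + s ^ 2 < m ^ 2 := by
  obtain h | h := le_or_gt (2 * p) (m - 1)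
  · have hq2 := pow_le_pow_left₀ hq hqp 2
    nlinarith [hq2, pow_le_pow_left₀ hr hrp 2, pow_le_pow_left₀ hs hsp 2]
  · nlinarith [pow_le_pow_left₀ hq (by omega : q ≤ m - 1 - p) 2,
      pow_le_pow_left₀ hr (by omega : r ≤ m - 1 - p) 2,
      pow_le_pow_left₀ hs (by omega : s ≤ m - 1 - p) 2,
      mul_nonneg (by omega : 0 ≤ m - 1 - p) (by omega : 0 ≤ 2 * p - m)]

lemma two_mul_inner_lt (h01 : |y₀| + |y₁| < m) (h02 : |y₀| + |y₂| < m) (h03 : |y₀| + |y₃| < m)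
    (h12 : |y₁| + |y₂| < m) (h13 : |y₁| + |y₃| < m) (h23 : |y₂| + |y₃| < m)
    {v₀ v₁ v₂ v₃ : ℤ} (he : Even (v₀ + v₁ + v₂ + v₃))
    (hv : 0 < v₀ ^ 2 + v₁ ^ 2 + v₂ ^ 2 + v₃ ^ 2) :
    2 * (y₀ * v₀ + y₁ * v₁ + y₂ * v₂ + y₃ * v₃) < m * (v₀ ^ 2 + v₁ ^ 2 + v₂ ^ 2 + v₃ ^ 2) := by
  obtain h | h := le_or_gt 4 (v₀ ^ 2 + v₁ ^ 2 + v₂ ^ 2 + v₃ ^ 2)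
  · have hN : y₀ ^ 2 + y₁ ^ 2 + y₂ ^ 2 + y₃ ^ 2 < m ^ 2 := by
      have := abs_nonneg y₀
      have := abs_nonneg y₁
      have := abs_nonneg y₂
      have := abs_nonneg y₃
      rw [← sq_abs y₀, ← sq_abs y₁, ← sq_abs y₂, ← sq_abs y₃]
      rcases (by omega : (|y₁| ≤ |y₀| ∧ |y₂| ≤ |y₀| ∧ |y₃| ≤ |y₀|) ∨
        (|y₀| ≤ |y₁| ∧ |y₂| ≤ |y₁| ∧ |y₃| ≤ |y₁|) ∨
        (|y₀| ≤ |y₂| ∧ |y₁| ≤ |y₂| ∧ |y₃| ≤ |y₂|) ∨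
        (|y₀| ≤ |y₃| ∧ |y₁| ≤ |y₃| ∧ |y₂| ≤ |y₃|)) with
        ⟨ha, hb, hc⟩ | ⟨ha, hb, hc⟩ | ⟨ha, hb, hc⟩ | ⟨ha, hb, hc⟩
      · linarith [sum_sq_lt_sq (by omega) (by omega) (by omega) (by omega) ha hb hc
          (by omega) (by omega) (by omega : _ < m)]
      · linarith [sum_sq_lt_sq (by omega) (by omega) (by omega) (by omega) ha hb hc
          (by omega) (by omega) (by omega : _ < m)]
      · linarith [sum_sq_lt_sq (by omega) (by omega) (by omega) (by omega) ha hb hc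
          (by omega) (by omega) (by omega : _ < m)]
      · linarith [sum_sq_lt_sq (by omega) (by omega) (by omega) (by omega) ha hb hc
          (by omega) (by omega) (by omega : _ < m)]
    have hm0 : 0 < m := by
      have := abs_nonneg y₀
      have := abs_nonneg y₁
      omega
    set n := v₀ ^ 2 + v₁ ^ 2 + v₂ ^ 2 + v₃ ^ 2 with hn
    have hCS : (y₀ * v₀ + y₁ * v₁ + y₂ * v₂ + y₃ * v₃) ^ 2 ≤
        (y₀ ^ 2 + y₁ ^ 2 + y₂ ^ 2 + y₃ ^ 2) * n := by
      rw [hn]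
      linarith [sq_nonneg (y₀ * v₁ - y₁ * v₀), sq_nonneg (y₀ * v₂ - y₂ * v₀),
        sq_nonneg (y₀ * v₃ - y₃ * v₀), sq_nonneg (y₁ * v₂ - y₂ * v₁),
        sq_nonneg (y₁ * v₃ - y₃ * v₁), sq_nonneg (y₂ * v₃ - y₃ * v₂)]
    have h1 : (y₀ ^ 2 + y₁ ^ 2 + y₂ ^ 2 + y₃ ^ 2) * n < m ^ 2 * n :=
      mul_lt_mul_of_pos_right hN hv
    have h2 : m ^ 2 * n * 4 ≤ m ^ 2 * n * n := mul_le_mul_of_nonneg_left h (by positivity)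
    refine lt_of_pow_lt_pow_left₀ 2 (by positivity) ?_
    nlinarith
  · have b0 : -1 ≤ v₀ ∧ v₀ ≤ 1 := by constructor <;> nlinarith
    have b1 : -1 ≤ v₁ ∧ v₁ ≤ 1 := by constructor <;> nlinarith
    have b2 : -1 ≤ v₂ ∧ v₂ ≤ 1 := by constructor <;> nlinarith
    have b3 : -1 ≤ v₃ ∧ v₃ ≤ 1 := by constructor <;> nlinarith
    obtain ⟨b0, b0'⟩ := b0
    obtain ⟨b1, b1'⟩ := b1
    obtain ⟨b2, b2'⟩ := b2
    obtain ⟨b3, b3'⟩ := b3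
    obtain ⟨k, hk⟩ := he
    have := le_abs_self y₀
    have := le_abs_self y₁
    have := le_abs_self y₂
    have := le_abs_self y₃
    have := neg_abs_le y₀
    have := neg_abs_le y₁
    have := neg_abs_le y₂
    have := neg_abs_le y₃
    interval_cases v₀ <;> interval_cases v₁ <;> interval_cases v₂ <;> interval_cases v₃ <;> omega

end Arithmetic

lemma gpCoord_vecMul (a b : ℤ) (c : Fin 4 → ℤ) :
    c ᵥ* gpCoord a b =
      ![-(2 * b + 1) * c 1 + (2 * a + 1) * c 2 + (2 * b + 1) * c 3,
        (a - b) * c 1 + (a + b + 1) * c 2 + (b - a) * c 3,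
        (b - a) * c 0 - (2 * b + 1) * c 1 + (2 * a + 1) * c 2,
        -(a + b + 1) * c 0 + (a - b) * c 1 + (a + b + 1) * (c 2 + c 3)] := by
  ext i
  fin_cases i <;> simp [vecMul, dotProduct, Fin.sum_univ_four, gpCoord] <;> ring

/-- The image of `d ᵥ* d4Basis` under the transpose of `rightMul (2a+1) (2b+1)`. -/
def dualCoord (a b : ℤ) (d : Fin 4 → ℤ) : Fin 4 → ℤ :=
  ![a * (2 * d 0 - d 1 - d 2 - d 3) + b * (d 1 + d 2 - d 3) + (d 0 - d 3),
    a * (d 1 - d 2 - d 3) + b * (d 2 - d 3 - d 1) - d 3,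
    b * (d 1 - d 2 - d 3) + a * (d 1 - d 2 + d 3) + (d 1 - d 2),
    a * (d 1 + d 2 - d 3) - b * (2 * d 0 - d 1 - d 2 - d 3) + (d 1 + d 2 - d 0)]

lemma sqNorm_sub_vecMul (a b : ℤ) (d c : Fin 4 → ℤ) :
    sqNorm (d ᵥ* d4Basis - c ᵥ* (gpCoord a b * d4Basis)) = sqNorm (d ᵥ* d4Basis) -
      2 * (dualCoord a b d 0 * (c 0 - c 1) + dualCoord a b d 1 * (c 0 - c 2 - c 3) +
        dualCoord a b d 2 * c 1 + dualCoord a b d 3 * (c 2 - c 3)) +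
      (2 * a ^ 2 + 2 * a + 2 * b ^ 2 + 2 * b + 1) *
        ((c 0 - c 1) ^ 2 + (c 0 - c 2 - c 3) ^ 2 + c 1 ^ 2 + (c 2 - c 3) ^ 2) := by
  rw [← vecMul_vecMul, d4Basis_vecMul, d4Basis_vecMul, gpCoord_vecMul]
  simp [sqNorm, dualCoord]
  ring

/-- A point of `D4` for which the origin is a nearest lattice point has no other nearest point. -/
lemma sqNorm_lt_of_forall_le {a b : ℤ} (hcop : IsCoprime (2 * a + 1) (2 * b + 1))
    {x : Fin 4 → ℤ} (hx : x ∈ rowSpan d4Basis)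
    (h : ∀ q ∈ rowSpan (gpCoord a b * d4Basis), sqNorm x ≤ sqNorm (x - q))
    {q : Fin 4 → ℤ} (hq : q ∈ rowSpan (gpCoord a b * d4Basis)) (hq0 : q ≠ 0) :
    sqNorm x < sqNorm (x - q) := by
  obtain ⟨d, rfl⟩ := mem_rowSpan.mp hx
  obtain ⟨c, rfl⟩ := mem_rowSpan.mp hq
  have hdet : 2 * (2 * a ^ 2 + 2 * a + 2 * b ^ 2 + 2 * b + 1) =
      (2 * a + 1) ^ 2 + (2 * b + 1) ^ 2 := by ring
  have hk₀ : 2 * a ^ 2 + 2 * a + 2 * b ^ 2 + 2 * b + 1 = 2 * (a ^ 2 + a + b ^ 2 + b) + 1 := by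
    ring
  have hsub := sqNorm_sub_vecMul a b d
  have h1 : (2 * a ^ 2 + 2 * a + 2 * b ^ 2 + 2 * b + 1) ∣
      (2 * a + 1) * dualCoord a b d 0 - (2 * b + 1) * dualCoord a b d 3 :=
    ⟨2 * d 0 - d 1 - d 2 - d 3, by simp [dualCoord]; ring⟩
  have h2 : (2 * a ^ 2 + 2 * a + 2 * b ^ 2 + 2 * b + 1) ∣
      (2 * a + 1) * dualCoord a b d 1 + (2 * b + 1) * dualCoord a b d 2 :=
    ⟨d 1 - d 2 - d 3, by simp [dualCoord]; ring⟩
  have he : Even (dualCoord a b d 0 + dualCoord a b d 1 + dualCoord a b d 2 +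
      dualCoord a b d 3) :=
    ⟨a * (d 0 + d 1 - d 2 - d 3) + b * (d 1 + d 2 - d 3 - d 0) + d 1 - d 3, by
      simp [dualCoord]; ring⟩
  generalize dualCoord a b d = y at *
  set m := 2 * a ^ 2 + 2 * a + 2 * b ^ 2 + 2 * b + 1 with hm
  have hodd : Odd m := ⟨_, hk₀⟩
  have hpos : 0 < m := by
    have h₀ : 0 ≤ 2 * m := by rw [hdet]; positivity
    obtain ⟨n, hn⟩ := hodd
    omega
  have hα : IsCoprime m (2 * a + 1) := by
    refine IsCoprime.of_mul_left_right (x := 2) ?_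
    rw [hdet, sq (2 * a + 1), IsCoprime.mul_add_left_left_iff]
    exact hcop.symm.pow_left
  have hβ : IsCoprime m (2 * b + 1) := by
    refine IsCoprime.of_mul_left_right (x := 2) ?_
    rw [hdet, sq (2 * b + 1), IsCoprime.add_mul_left_left_iff]
    exact hcop.pow_left
  have hle (v₀ v₁ v₂ v₃ k : ℤ) (hk : v₀ + v₁ + v₂ + v₃ = k + k) :
      2 * (y 0 * v₀ + y 1 * v₁ + y 2 * v₂ + y 3 * v₃) ≤
        m * (v₀ ^ 2 + v₁ ^ 2 + v₂ ^ 2 + v₃ ^ 2) := by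
    have := h _ (mem_rowSpan.mpr ⟨![v₀ + v₂, v₂, k - v₁, k - v₁ - v₃], rfl⟩)
    rw [hsub] at this
    simp only [cons_val] at this
    rw [show v₀ + v₂ - v₂ = v₀ by ring,
      show v₀ + v₂ - (k - v₁) - (k - v₁ - v₃) = v₁ by linear_combination hk,
      show k - v₁ - (k - v₁ - v₃) = v₃ by ring] at this
    linarith
  have habs {p r : ℤ} (h₁ : p + r ≤ m) (h₂ : p - r ≤ m) (h₃ : -p + r ≤ m) (h₄ : -p - r ≤ m) :
      |p| + |r| ≤ m := by
    have := abs_eq_max_neg (a := p)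
    have := abs_eq_max_neg (a := r)
    omega
  obtain ⟨s1, s2, s3, s4, s5, s6⟩ := abs_add_abs_lt hodd hpos hdet hα hβ he h1 h2
    (habs (by linarith [hle 1 1 0 0 1 rfl]) (by linarith [hle 1 (-1) 0 0 0 rfl])
      (by linarith [hle (-1) 1 0 0 0 rfl]) (by linarith [hle (-1) (-1) 0 0 (-1) rfl]))
    (habs (by linarith [hle 1 0 1 0 1 rfl]) (by linarith [hle 1 0 (-1) 0 0 rfl])
      (by linarith [hle (-1) 0 1 0 0 rfl]) (by linarith [hle (-1) 0 (-1) 0 (-1) rfl]))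
    (habs (by linarith [hle 1 0 0 1 1 rfl]) (by linarith [hle 1 0 0 (-1) 0 rfl])
      (by linarith [hle (-1) 0 0 1 0 rfl]) (by linarith [hle (-1) 0 0 (-1) (-1) rfl]))
    (habs (by linarith [hle 0 1 1 0 1 rfl]) (by linarith [hle 0 1 (-1) 0 0 rfl])
      (by linarith [hle 0 (-1) 1 0 0 rfl]) (by linarith [hle 0 (-1) (-1) 0 (-1) rfl]))
    (habs (by linarith [hle 0 1 0 1 1 rfl]) (by linarith [hle 0 1 0 (-1) 0 rfl])
      (by linarith [hle 0 (-1) 0 1 0 rfl]) (by linarith [hle 0 (-1) 0 (-1) (-1) rfl]))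
    (habs (by linarith [hle 0 0 1 1 1 rfl]) (by linarith [hle 0 0 1 (-1) 0 rfl])
      (by linarith [hle 0 0 (-1) 1 0 rfl]) (by linarith [hle 0 0 (-1) (-1) (-1) rfl]))
  have hv : 0 < (c 0 - c 1) ^ 2 + (c 0 - c 2 - c 3) ^ 2 + c 1 ^ 2 + (c 2 - c 3) ^ 2 := by
    refine lt_of_le_of_ne (by positivity) fun h0 => hq0 ?_
    have e1 : c 1 = 0 := by nlinarith
    have e0 : c 0 - c 1 = 0 := by nlinarith
    have e2 : c 0 - c 2 - c 3 = 0 := by nlinarith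
    have e3 : c 2 - c 3 = 0 := by nlinarith
    have : c = 0 := by
      ext i
      fin_cases i <;> simp <;> omega
    rw [this, zero_vecMul]
  have := two_mul_inner_lt s1 s2 s3 s4 s5 s6 (v₀ := c 0 - c 1) (v₁ := c 0 - c 2 - c 3)
    (v₂ := c 1) (v₃ := c 2 - c 3) ⟨c 0 - c 3, by ring⟩ hv
  rw [hsub]
  linarith

/-- Every integer point has a nearest point in an integer lattice. -/
lemma exists_sqNorm_sub_le (L : AddSubgroup (Fin 4 → ℤ)) (x : Fin 4 → ℤ) :
    ∃ p ∈ L, ∀ q ∈ L, sqNorm (x - p) ≤ sqNorm (x - q) := by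
  obtain ⟨p, hp, hmin⟩ := (measure fun p => (sqNorm (x - p)).toNat).wf.has_min
    (L : Set (Fin 4 → ℤ)) ⟨0, L.zero_mem⟩
  refine ⟨p, hp, fun q hq => ?_⟩
  have h0 (v : Fin 4 → ℤ) : 0 ≤ sqNorm v := by unfold sqNorm; positivity
  have h1 : ¬ (sqNorm (x - q)).toNat < (sqNorm (x - p)).toNat := hmin q hq
  have := h0 (x - p)
  have := h0 (x - q)
  omega

lemma isClean_map_intVec {L L' : AddSubgroup (Fin 4 → ℤ)} (hL : L' ≤ L)
    (h : ∀ x ∈ L, (∀ q ∈ L', sqNorm x ≤ sqNorm (x - q)) →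
      ∀ q ∈ L', q ≠ 0 → sqNorm x < sqNorm (x - q)) :
    IsClean (L.map intVec) (L'.map intVec) := by
  rintro _ ⟨x, hx, rfl⟩
  obtain ⟨p, hp, hmin⟩ := exists_sqNorm_sub_le L' x
  refine ⟨intVec p, ⟨⟨p, hp, rfl⟩, ?_⟩, ?_⟩
  · rintro _ ⟨q, hq, rfl⟩
    rw [← map_sub, ← map_sub, norm_intVec_le_iff]
    exact hmin q hq
  · rintro _ ⟨⟨p', hp', rfl⟩, hmin'⟩
    by_contra hne
    have hlt := h (x - p) (L.sub_mem hx (hL hp)) (fun q hq => by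
      rw [sub_sub]; exact hmin _ (L'.add_mem hp hq)) (p' - p) (L'.sub_mem hp' hp)
      (sub_ne_zero.mpr fun e => hne (by rw [e]))
    have hle := hmin' (intVec p) ⟨p, hp, rfl⟩
    rw [← map_sub, ← map_sub, norm_intVec_le_iff] at hle
    rw [sub_sub_sub_cancel_right] at hlt
    exact absurd hle (not_le.mpr (by convert hlt using 2))

lemma rowSpan_mul_le (A B : Matrix (Fin 4) (Fin 4) ℤ) : rowSpan (A * B) ≤ rowSpan B := by
  rintro _ ⟨c, rfl⟩
  exact mem_rowSpan.mpr ⟨c ᵥ* A, vecMul_vecMul c A B⟩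

theorem stmt15 (α β : ℤ) (hαodd : Odd α) (hβodd : Odd β)
    (hαpos : 0 < α) (hβpos : 0 < β) (hcop : IsCoprime α β) :
    GpLattice (α : ℝ) (β : ℝ) ≤ D4 ∧
      (∃ N : ℕ, (N : ℤ) = ((α ^ 2 + β ^ 2) / 2) ^ 2 ∧
        IsStrictlySimilarSublattice D4 (GpLattice (α : ℝ) (β : ℝ)) N) ∧
      IsClean D4 (GpLattice (α : ℝ) (β : ℝ)) := by
  obtain ⟨a, rfl⟩ := hαodd
  obtain ⟨b, rfl⟩ := hβodd
  have hle : GpLattice ((2 * a + 1 : ℤ) : ℝ) ((2 * b + 1 : ℤ) : ℝ) ≤ D4 := by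
    rw [GpLattice_eq_map_rowSpan, D4_eq_map_rowSpan]
    exact AddSubgroup.map_mono (rowSpan_mul_le _ _)
  refine ⟨hle, ⟨_, ?_, hle, relIndex_GpLattice a b, exists_rotation _ _ ?_⟩, ?_⟩
  · rw [Int.natCast_natAbs, abs_of_nonneg (sq_nonneg _)]
    congr 1
    symm
    apply Int.ediv_eq_of_eq_mul_right two_ne_zero
    ring
  · have : (0 : ℝ) < ((2 * a + 1 : ℤ) : ℝ) := by exact_mod_cast hαpos
    positivity
  · rw [GpLattice_eq_map_rowSpan, D4_eq_map_rowSpan]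
    exact isClean_map_intVec (rowSpan_mul_le _ _) fun x hx h q hq hq0 =>
      sqNorm_lt_of_forall_le hcop hx h hq hq0
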